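/- Let G ⊊ ℝⁿ be a domain (so that, viewed as a subset of ℝ̄ⁿ, its boundary has at least two points). Then for all x, y ∈ G, ρ_G(x,y) ≤ (arcosh 3 / log 2) · j_G(x,y). -/

import Mathlib

open OnePoint

noncomputable section

/-- Inverse hyperbolic cosine: arcosh t = log (t + √(t² − 1)). -/
def arcosh (t : ℝ) : ℝ := Real.log (t + Real.sqrt (t ^ 2 - 1))

/-- Euclidean n-space. -/
abbrev En (n : ℕ) : Type := EuclideanSpace ℝ (Fin n)

/-- The chordal (spherical) metric on the one-point compactification ℝ̄ⁿ of ℝⁿ. -/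
def chordal {n : ℕ} : OnePoint (En n) → OnePoint (En n) → ℝ
  | ∞, ∞ => 0
  | ∞, (y : En n) => 1 / Real.sqrt (1 + ‖y‖ ^ 2)
  | (x : En n), ∞ => 1 / Real.sqrt (1 + ‖x‖ ^ 2)
  | (x : En n), (y : En n) => ‖x - y‖ / (Real.sqrt (1 + ‖x‖ ^ 2) * Real.sqrt (1 + ‖y‖ ^ 2))

/-- The cross-ratio |a,b,c,d| = q(a,c)q(b,d)/(q(a,b)q(c,d)) in the chordal metric. -/
def crossRatio {n : ℕ} (a b c d : OnePoint (En n)) : ℝ :=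
  chordal a c * chordal b d / (chordal a b * chordal c d)

/-- The generalized hyperbolic metric ρ_G(x,y) = sup_{a,b ∈ ∂G} arcosh(1 + |a,x,b,y||a,y,b,x|/2). -/
def rho {n : ℕ} (G : Set (OnePoint (En n))) (x y : OnePoint (En n)) : ℝ :=
  sSup {r : ℝ | ∃ a ∈ frontier G, ∃ b ∈ frontier G,
    r = arcosh (1 + crossRatio a x b y * crossRatio a y b x / 2)}

/-- Seittenranta's metric δ_G(x,y) = sup_{a,b ∈ ∂G} log(1 + |a,x,b,y|). -/
def seittenranta {n : ℕ} (G : Set (OnePoint (En n))) (x y : OnePoint (En n)) : ℝ :=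
  sSup {r : ℝ | ∃ a ∈ frontier G, ∃ b ∈ frontier G,
    r = Real.log (1 + crossRatio a x b y)}

/-- The j-metric j_G(x,y) = log(1 + |x−y|/min(d(x,∂G), d(y,∂G))). -/
def jMetric {n : ℕ} (G : Set (En n)) (x y : En n) : ℝ :=
  Real.log (1 + ‖x - y‖ / min (Metric.infDist x (frontier G)) (Metric.infDist y (frontier G)))

/-- The metric δ_G^p(x,y) = sup_{a,b ∈ ∂G} log(1 + (|x,a,y,b|^p + |x,b,y,a|^p)^(1/p)). -/
def deltaP {n : ℕ} (p : ℝ) (G : Set (OnePoint (En n))) (x y : OnePoint (En n)) : ℝ :=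
  sSup {r : ℝ | ∃ a ∈ frontier G, ∃ b ∈ frontier G,
    r = Real.log (1 + (crossRatio x a y b ^ p + crossRatio x b y a ^ p) ^ (1 / p))}

/-- The metric j_G^p(x,y) = sup_{a ∈ ∂G} log(1 + (|x−y|^p/|x−a|^p + |x−y|^p/|y−a|^p)^(1/p)). -/
def jP {n : ℕ} (p : ℝ) (G : Set (En n)) (x y : En n) : ℝ :=
  sSup {r : ℝ | ∃ a ∈ frontier G,
    r = Real.log (1 + (‖x - y‖ ^ p / ‖x - a‖ ^ p + ‖x - y‖ ^ p / ‖y - a‖ ^ p) ^ (1 / p))}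

lemma core1 (w s P Q: ℝ) (hs : 2 ≤ s) (hw : s ≤ w) (hP : P ≤ s) (hQ : Q ≤ s) (hPQ : P*Q = w)
   (hP1 : 1 ≤ P) (hQ1 : 1 ≤ Q)
   (h : s^2*w < (w+1)^2) : (s-1)^2*((1+P)*(1+Q)) ≤ s^2*w := by
  have h1 : s^2 - 5/2 ≤ w := by
    by_contra hc
    push Not at hc
    nlinarith
  have h2 : s*(s-1)^2*(s+1) ≤ w*(s^2+s-1) := by
    have : s*(s-1)^2*(s+1) ≤ (s^2-5/2)*(s^2+s-1) := by
      nlinarith [mul_nonneg (sub_nonneg.2 hs) (sub_nonneg.2 hs), mul_nonneg (mul_nonneg (sub_nonneg.2 hs) (sub_nonneg.2 hs)) (sub_nonneg.2 hs)]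
    nlinarith [mul_le_mul_of_nonneg_right h1 (by nlinarith : 0 ≤ s^2+s-1)]
  have h3 : s*(P+Q) ≤ s^2+w := by nlinarith [mul_nonneg (sub_nonneg.2 hP) (sub_nonneg.2 hQ)]
  have h4 : s*((1+P)*(1+Q)) ≤ (s+1)*(w+s) := by nlinarith
  have h5 : s*((s-1)^2*((1+P)*(1+Q))) ≤ s*(s^2*w) := by
    nlinarith [mul_le_mul_of_nonneg_left h4 (sq_nonneg (s-1))]
  exact le_of_mul_le_mul_left h5 (by linarith)

lemma core2 (w s : ℝ) (hs : 2 ≤ s) (hw : w ≤ s) (h1 : 1 ≤ w)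
   (h : s^2*w < (w+1)^2) : (s-1)^2*(2*(1+w)) ≤ s^2*w := by
  have h2 : s^2 - 3 ≤ w := by
    by_contra hc
    push Not at hc
    nlinarith
  have h3 : s ≤ 2.31 := by nlinarith
  have h4 : 0 ≤ -s^2+4*s-2 := by nlinarith
  have h5 : 2*(s-1)^2 ≤ (s^2-3)*(-s^2+4*s-2) := by
    have : 0 ≤ (s-2)*(-s^3+2*s^2+3*s-2) := by
      apply mul_nonneg (by linarith)
      nlinarith [mul_nonneg (sub_nonneg.2 hs) (sub_nonneg.2 h3)]
    nlinarith
  nlinarith [mul_le_mul_of_nonneg_right h2 h4]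

lemma core3a (P Q q u : ℝ) (hp : 1 ≤ P*q) (hv : 1 ≤ Q*u) (hq : 1 ≤ q) (hu : 1 ≤ u)
    (hP0 : 0 < P) (hQ0 : 0 < Q) (hw1 : 1 ≤ P*Q) : P*q^2 + Q*u^2 ≤ (1+P*Q)*(q*u)^2 := by
  have q2 : 1 ≤ q^2 := by nlinarith
  have u2 : 1 ≤ u^2 := by nlinarith
  have b1 : 1 ≤ P*q^2 := by nlinarith
  have b2 : 1 ≤ Q*u^2 := by nlinarith
  nlinarith [mul_nonneg (sub_nonneg.2 b1) (sub_nonneg.2 b2), mul_nonneg (sub_nonneg.2 q2) (sub_nonneg.2 u2)]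

lemma core3 (p q u v m t : ℝ) (hp : 1 ≤ p) (hq : 1 ≤ q) (hu : 1 ≤ u) (hv : 1 ≤ v) (hm : 0 ≤ m)
   (ht : 1 ≤ t) (h1 : p ≤ q + t) (h4 : v ≤ u + t)
   (m1 : m ≤ p + u) (m2 : m ≤ q + v) (mt : m * t ≤ p * v + q * u) (hw : q * u ≤ p * v) :
   (m*t)^2 ≤ (1+t)^2*(p*q*u*v) := by
  obtain ⟨P, rfl⟩ : ∃ P, p = P * q := ⟨p/q, by field_simp⟩
  obtain ⟨Q, rfl⟩ : ∃ Q, v = Q * u := ⟨v/u, by field_simp⟩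
  have hqu : 1 ≤ q*u := by nlinarith
  have hP : P ≤ 1+t := by
    by_contra hc; push Not at hc; nlinarith
  have hQ : Q ≤ 1+t := by
    by_contra hc; push Not at hc; nlinarith
  have hP0 : 0 < P := by
    by_contra hc; push Not at hc; nlinarith
  have hQ0 : 0 < Q := by
    by_contra hc; push Not at hc; nlinarith
  have hw1 : 1 ≤ P*Q := by
    by_contra hc; push Not at hc; nlinarith
  have hqu2 : q*u ≤ (q*u)^2 := by nlinarith
  by_cases hc : (P*Q+1)^2 ≤ (1+t)^2*(P*Q)
  · have : (m*t)^2 ≤ ((P*Q+1)*(q*u))^2 := by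
      apply pow_le_pow_left₀ (by positivity)
      nlinarith
    have h6 := mul_le_mul_of_nonneg_right hc (sq_nonneg (q*u))
    nlinarith
  push Not at hc
  have hm2 : m^2 ≤ (P*q+u)*(q+Q*u) := by nlinarith
  suffices h : t^2*((P*q+u)*(q+Q*u)) ≤ (1+t)^2*((P*Q)*(q*u)^2) by
    nlinarith [mul_le_mul_of_nonneg_left hm2 (sq_nonneg t)]
  have q1 : q^2 ≤ (q*u)^2 := pow_le_pow_left₀ (by linarith) (by nlinarith) 2
  have u1 : u^2 ≤ (q*u)^2 := pow_le_pow_left₀ (by linarith) (by nlinarith) 2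
  have exp : (P*q+u)*(q+Q*u) = P*q^2 + Q*u^2+(P*Q+1)*(q*u) := by ring
  have e3 : (P*Q+1)*(q*u) ≤ (P*Q+1)*(q*u)^2 := mul_le_mul_of_nonneg_left hqu2 (by linarith)
  have fin : ∀ A : ℝ, (P*q+u)*(q+Q*u) ≤ A*(q*u)^2 → t^2*A ≤ (1+t)^2*(P*Q) → 
      t^2*((P*q+u)*(q+Q*u)) ≤ (1+t)^2*((P*Q)*(q*u)^2) := by
    intro A hA hB
    have := mul_le_mul_of_nonneg_left hA (sq_nonneg t)
    have := mul_le_mul_of_nonneg_right hB (sq_nonneg (q*u))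
    nlinarith
  rcases le_total (1+t) (P*Q) with hb | hb
  · have hP1 : 1 ≤ P := by
      by_contra hc; push Not at hc; nlinarith
    have hQ1 : 1 ≤ Q := by
      by_contra hc; push Not at hc; nlinarith
    refine fin ((1+P)*(1+Q)) ?_ ?_
    · rw [exp]
      nlinarith [mul_le_mul_of_nonneg_left q1 hP0.le, mul_le_mul_of_nonneg_left u1 hQ0.le]
    · have := core1 (P*Q) (1+t) P Q (by linarith) hb hP hQ rfl hP1 hQ1 hc
      simpa using this
  · refine fin (2*(1+P*Q)) ?_ (by simpa using core2 (P*Q) (1+t) (by linarith) hb hw1 hc)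
    rw [exp]
    have := core3a P Q q u hp hv hq hu hP0 hQ0 hw1
    linarith

lemma core4 (p q u v m t : ℝ) (hp : 1 ≤ p) (hq : 1 ≤ q) (hu : 1 ≤ u) (hv : 1 ≤ v) (hm : 0 ≤ m)
   (m1 : m ≤ p + u) (m2 : m ≤ q + v)  :
   (m*t)^2 ≤ 4*t^2*(p*q*u*v) := by
  have a : p+u ≤ 2*(p*u) := by nlinarith
  have b : q+v ≤ 2*(q*v) := by nlinarith
  have : m*m ≤ (2*(p*u))*(2*(q*v)) := mul_le_mul (by linarith) (by linarith) hm (by positivity)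
  nlinarith [mul_le_mul_of_nonneg_left this (sq_nonneg t)]

lemma arsA (q : ℝ) (hq : 1 ≤ q) : Real.arsinh q ≤ Real.arsinh 1 / Real.log 2 * Real.log (2*q) := by
  have hl : 0 < Real.log 2 := Real.log_pos (by norm_num)
  have hlq : 0 ≤ Real.log q := Real.log_nonneg hq
  have h1 : Real.log 2 ≤ Real.arsinh 1 := by
    unfold Real.arsinh
    apply Real.log_le_log (by norm_num)
    have : 1 ≤ √(1+1^2:ℝ) := Real.one_le_sqrt.2 (by norm_num)
    linarith
  have h2 : Real.arsinh q ≤ Real.log q + Real.arsinh 1 := by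
    unfold Real.arsinh
    rw [← Real.log_mul (by linarith) (by positivity)]
    apply Real.log_le_log (by positivity)
    have : √(1+q^2) ≤ q * √(1+1^2) := by
      rw [Real.sqrt_le_left (by positivity), mul_pow, Real.sq_sqrt (by norm_num)]
      nlinarith
    linarith
  rw [Real.log_mul (by norm_num) (by linarith), mul_add, div_mul_cancel₀ _ hl.ne']
  have : 1 ≤ Real.arsinh 1 / Real.log 2 := by rwa [le_div_iff₀ hl, one_mul]
  nlinarith

lemma arsB (t : ℝ) (h0 : 0 ≤ t) (h1 : t ≤ 1) : Real.arsinh t ≤ Real.arsinh 1 / Real.log 2 * Real.log (1+t) := by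
  have hl : 0 < Real.log 2 := Real.log_pos (by norm_num)
  have hd : ∀ v : ℝ, HasDerivAt (fun v => Real.arsinh (Real.exp v - 1)) 
      ((√(1+(Real.exp v - 1)^2))⁻¹ * Real.exp v) v := by
    intro v
    exact (Real.hasDerivAt_arsinh _).comp v ((Real.hasDerivAt_exp v).sub_const 1)
  have hc : ConvexOn ℝ (Set.Icc 0 (Real.log 2)) (fun v => Real.arsinh (Real.exp v - 1)) := by
    apply MonotoneOn.convexOn_of_deriv (convex_Icc _ _)
    · exact fun v _ => (hd v).continuousAt.continuousWithinAt
    · exact fun v _ => (hd v).differentiableAt.differentiableWithinAt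
    · intro a ha b hb hab
      rw [interior_Icc] at ha hb
      rw [(hd a).deriv, (hd b).deriv]
      have h3 : 1 ≤ Real.exp a := Real.one_le_exp ha.1.le
      have h4 : Real.exp a ≤ Real.exp b := Real.exp_le_exp.2 hab
      have h5 : Real.exp b ≤ 2 := by
        rw [← Real.exp_log (by norm_num : (0:ℝ) < 2)]; exact Real.exp_le_exp.2 hb.2.le
      generalize Real.exp a = A at *
      generalize Real.exp b = B at *
      rw [inv_mul_eq_div, inv_mul_eq_div, div_le_div_iff₀ (by positivity) (by positivity)]
      refine (sq_le_sq₀ (mul_nonneg (by linarith) (Real.sqrt_nonneg _)) (mul_nonneg (by linarith) (Real.sqrt_nonneg _))).1 ?_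
      rw [mul_pow, mul_pow, Real.sq_sqrt (by positivity), Real.sq_sqrt (by positivity)]
      have : 0 ≤ (B-A)*(A+B-A*B) := mul_nonneg (by linarith) (by nlinarith)
      nlinarith
  have hv0 : 0 ≤ Real.log (1+t) := Real.log_nonneg (by linarith)
  have hv1 : Real.log (1+t) ≤ Real.log 2 := Real.log_le_log (by linarith) (by linarith)
  have := hc.2 (Set.left_mem_Icc.2 hl.le) (Set.right_mem_Icc.2 hl.le) 
    (sub_nonneg.2 ((div_le_one hl).2 hv1)) (div_nonneg hv0 hl.le) (by ring)
  simp only [smul_eq_mul, mul_zero, zero_add, div_mul_cancel₀ _ hl.ne', Real.exp_log (by linarith : 0 < 1+t), Real.exp_log (by norm_num : (0:ℝ) < 2), Real.exp_zero, sub_self, Real.arsinh_zero] at this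
  norm_num at this
  calc _ ≤ _ := this
    _ = _ := by ring

lemma arcosh_eq (τ : ℝ) (h : 0 ≤ τ) : arcosh (1 + 2*τ^2) = 2 * Real.arsinh τ := by
  have h1 : √((1+2*τ^2)^2 - 1) = 2*τ*√(1+τ^2) := by
    rw [show (1+2*τ^2)^2 - 1 = (2*τ)^2*(1+τ^2) by ring, Real.sqrt_mul (by positivity),
      Real.sqrt_sq (by positivity)]
  unfold arcosh Real.arsinh
  rw [h1, show 1+2*τ^2 + 2*τ*√(1+τ^2) = (τ + √(1+τ^2))^2 by
    rw [add_sq, Real.sq_sqrt (by positivity)]; ring, Real.log_pow]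
  norm_num

lemma arcosh_bound (X t : ℝ) (hX : 0 ≤ X) (ht : 0 ≤ t) (h1 : X ≤ 4*t^2)
    (h2 : 1 ≤ t → X ≤ (1+t)^2) :
    arcosh (1 + X/2) ≤ arcosh 3 / Real.log 2 * Real.log (1+t) := by
  have e3 : arcosh 3 = 2 * Real.arsinh 1 := by
    rw [← arcosh_eq 1 (by norm_num)]; norm_num
  obtain ⟨τ, hτ, rfl⟩ : ∃ τ : ℝ, 0 ≤ τ ∧ X = 4*τ^2 :=
    ⟨√X/2, by positivity, by rw [div_pow, Real.sq_sqrt hX]; ring⟩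
  rw [show 1 + 4*τ^2/2 = 1 + 2*τ^2 by ring, arcosh_eq τ hτ, e3]
  suffices h : Real.arsinh τ ≤ Real.arsinh 1 / Real.log 2 * Real.log (1+t) by
    calc _ ≤ 2 * (Real.arsinh 1 / Real.log 2 * Real.log (1+t)) := by linarith
      _ = _ := by ring
  rcases le_total t 1 with h | h
  · refine (Real.arsinh_le_arsinh.2 ?_).trans (arsB t ht h)
    nlinarith
  · have := h2 h
    have h3 : τ ≤ (1+t)/2 := by nlinarith
    refine (Real.arsinh_le_arsinh.2 h3).trans ((arsA _ (by linarith)).trans_eq ?_)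
    rw [mul_div_cancel₀ _ (by norm_num : (2:ℝ) ≠ 0)]

lemma core5 (p q u v m t : ℝ) (hp : 1 ≤ p) (hq : 1 ≤ q) (hu : 1 ≤ u) (hv : 1 ≤ v) (hm : 0 ≤ m)
   (ht : 1 ≤ t) (h1 : p ≤ q + t) (h2 : q ≤ p + t) (h3 : u ≤ v + t) (h4 : v ≤ u + t)
   (m1 : m ≤ p + u) (m2 : m ≤ q + v) (mt : m * t ≤ p * v + q * u) :
   (m*t)^2 ≤ (1+t)^2*(p*q*u*v) := by
  rcases le_total (q*u) (p*v) with h | h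
  · exact core3 p q u v m t hp hq hu hv hm ht h1 h4 m1 m2 mt h
  · have := core3 q p v u m t hq hp hv hu hm ht h2 h3 m2 m1 (by linarith) h
    linarith

/-- the product of cross ratios, finite points -/
lemma cr_fin {n : ℕ} (a b x y : En n) (hax : 0 < dist a x) (hay : 0 < dist a y)
    (hbx : 0 < dist b x) (hby : 0 < dist b y) :
    crossRatio (a : OnePoint (En n)) x b y * crossRatio (a : OnePoint (En n)) y b x
      = (dist a b * dist x y)^2 / (dist a x * dist a y * dist b x * dist b y) := by
  have hh : ∀ c e : En n, chordal (c : OnePoint (En n)) e =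
    dist c e / (√(1+‖c‖^2) * √(1+‖e‖^2)) := fun c e => by rw [dist_eq_norm]; rfl
  have hN : ∀ c : En n, 0 < √(1+‖c‖^2) := fun c => by positivity
  have := hN a
  have := hN b
  have := hN x
  have := hN y
  unfold crossRatio
  simp only [hh]
  rw [dist_comm y x]
  field_simp

lemma cr_inf {n : ℕ} (a x y : En n) (hax : 0 < dist a x) (hay : 0 < dist a y) :
    crossRatio (a : OnePoint (En n)) x ∞ y * crossRatio (a : OnePoint (En n)) y ∞ x
      = (dist x y)^2 / (dist a x * dist a y) := by
  have hh : ∀ c e : En n, chordal (c : OnePoint (En n)) e =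
    dist c e / (√(1+‖c‖^2) * √(1+‖e‖^2)) := fun c e => by rw [dist_eq_norm]; rfl
  have h1 : ∀ c : En n, chordal (c : OnePoint (En n)) ∞ = 1 / √(1+‖c‖^2) := fun c => rfl
  have h2 : ∀ c : En n, chordal ∞ (c : OnePoint (En n)) = 1 / √(1+‖c‖^2) := fun c => rfl
  have hN : ∀ c : En n, 0 < √(1+‖c‖^2) := fun c => by positivity
  have := hN a
  have := hN x
  have := hN y
  unfold crossRatio
  simp only [hh, h1, h2]
  rw [dist_comm y x]
  field_simp

lemma cr_inf' {n : ℕ} (b x y : En n) (hax : 0 < dist b x) (hay : 0 < dist b y) :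
    crossRatio (∞ : OnePoint (En n)) x b y * crossRatio (∞ : OnePoint (En n)) y b x
      = (dist x y)^2 / (dist b x * dist b y) := by
  have hh : ∀ c e : En n, chordal (c : OnePoint (En n)) e =
    dist c e / (√(1+‖c‖^2) * √(1+‖e‖^2)) := fun c e => by rw [dist_eq_norm]; rfl
  have h1 : ∀ c : En n, chordal (c : OnePoint (En n)) ∞ = 1 / √(1+‖c‖^2) := fun c => rfl
  have h2 : ∀ c : En n, chordal ∞ (c : OnePoint (En n)) = 1 / √(1+‖c‖^2) := fun c => rfl
  have hN : ∀ c : En n, 0 < √(1+‖c‖^2) := fun c => by positivity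
  have := hN b
  have := hN x
  have := hN y
  unfold crossRatio
  simp only [hh, h1, h2]
  rw [dist_comm y x, dist_comm b x, dist_comm b y]
  rw [dist_comm] at hax hay
  field_simp

lemma cr_inf_inf {n : ℕ} (x y : En n) :
    crossRatio (∞ : OnePoint (En n)) x ∞ y = 0 := by
  have : chordal (∞ : OnePoint (En n)) ∞ = 0 := rfl
  unfold crossRatio
  rw [this]; simp

lemma bound_inf {n : ℕ} (a x y : En n) (d : ℝ) (hd : 0 < d)
    (hax : d ≤ dist a x) (hay : d ≤ dist a y) :
    (dist x y)^2 / (dist a x * dist a y) ≤ (dist x y / d)^2 := by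
  rw [div_pow]
  apply div_le_div_of_nonneg_left (by positivity) (by positivity)
  nlinarith

lemma bound_fin {n : ℕ} (a b x y : En n) (d : ℝ) (hd : 0 < d)
    (hax : d ≤ dist a x) (hay : d ≤ dist a y) (hbx : d ≤ dist b x) (hby : d ≤ dist b y) :
    (dist a b * dist x y)^2 / (dist a x * dist a y * dist b x * dist b y)
      ≤ 4*(dist x y / d)^2 ∧
    (1 ≤ dist x y / d → (dist a b * dist x y)^2 / (dist a x * dist a y * dist b x * dist b y)
      ≤ (1 + dist x y / d)^2) := by
  have key : (dist a b * dist x y)^2 / (dist a x * dist a y * dist b x * dist b y) =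
      (dist a b / d * (dist x y / d))^2 /
        (dist a x / d * (dist a y / d) * (dist b x / d) * (dist b y / d)) := by
    have := hd.trans_le hax
    have := hd.trans_le hay
    have := hd.trans_le hbx
    have := hd.trans_le hby
    field_simp
  have o : ∀ z, d ≤ z → 1 ≤ z / d := fun z hz => by rwa [le_div_iff₀ hd, one_mul]
  have tri : ∀ z z' z'' : ℝ, z ≤ z' + z'' → z / d ≤ z' / d + z'' / d := fun z z' z'' h => by
    rw [← add_div]; exact div_le_div_of_nonneg_right h hd.le
  have h1 := o _ hax
  have h2 := o _ hay
  have h3 := o _ hbx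
  have h4 := o _ hby
  have m1 := tri _ _ _ (dist_triangle_right a b x)
  have m2 := tri _ _ _ (dist_triangle_right a b y)
  have t1 : dist a x / d ≤ dist a y / d + dist x y / d := tri _ _ _ (dist_triangle_right a x y)
  have t2 : dist a y / d ≤ dist a x / d + dist x y / d := tri _ _ _ (dist_triangle a x y)
  have t3 : dist b x / d ≤ dist b y / d + dist x y / d := tri _ _ _ (dist_triangle_right b x y)
  have t4 : dist b y / d ≤ dist b x / d + dist x y / d := tri _ _ _ (dist_triangle b x y)
  have pt : dist a b / d * (dist x y / d) ≤
      dist a x / d * (dist b y / d) + dist a y / d * (dist b x / d) := by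
    have := EuclideanGeometry.mul_dist_le_mul_dist_add_mul_dist a x b y
    rw [dist_comm x b] at this
    rw [div_mul_div_comm, div_mul_div_comm, div_mul_div_comm, ← add_div]
    apply div_le_div_of_nonneg_right _ (by positivity)
    linarith
  have hm : 0 ≤ dist a b / d := by positivity
  have pos : 0 < dist a x / d * (dist a y / d) * (dist b x / d) * (dist b y / d) := by positivity
  rw [key, div_le_iff₀ pos]
  refine ⟨core4 _ _ _ _ _ _ h1 h2 h3 h4 hm m1 m2, fun ht => ?_⟩
  rw [div_le_iff₀ pos]
  exact core5 _ _ _ _ _ _ h1 h2 h3 h4 hm ht t1 t2 t3 t4 m1 m2 pt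

/-- ρ_G ≤ (arcosh 3 / log 2) · j_G for a proper subdomain G of ℝⁿ, where ρ is computed for
G viewed as a subdomain of ℝ̄ⁿ = ℝⁿ ∪ {∞}. -/
theorem rho_le_const_mul_jMetric (n : ℕ) (hn : 2 ≤ n) (G : Set (En n))
    (hopen : IsOpen G) (hconn : IsConnected G) (hne : G ≠ Set.univ)
    (x y : En n) (hx : x ∈ G) (hy : y ∈ G) :
    rho (((↑) : En n → OnePoint (En n)) '' G) (x : OnePoint (En n)) (y : OnePoint (En n)) ≤
      (arcosh 3 / Real.log 2) * jMetric G x y := by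
  have hfr : (frontier G).Nonempty := nonempty_frontier_iff.2 ⟨hconn.nonempty, hne⟩
  have hdp : ∀ z ∈ G, 0 < Metric.infDist z (frontier G) := by
    intro z hz
    refine (isClosed_frontier.notMem_iff_infDist_pos hfr).1 ?_
    rw [hopen.frontier_eq]
    exact fun h => h.2 hz
  unfold jMetric rho
  rw [← dist_eq_norm]
  have hd1 : min (Metric.infDist x (frontier G)) (Metric.infDist y (frontier G)) ≤
    Metric.infDist x (frontier G) := min_le_left _ _
  have hd2 : min (Metric.infDist x (frontier G)) (Metric.infDist y (frontier G)) ≤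
    Metric.infDist y (frontier G) := min_le_right _ _
  have hd : 0 < min (Metric.infDist x (frontier G)) (Metric.infDist y (frontier G)) :=
    lt_min (hdp x hx) (hdp y hy)
  generalize min (Metric.infDist x (frontier G)) (Metric.infDist y (frontier G)) = d at *
  have hF : ∀ a : En n, (a : OnePoint (En n)) ∈
      frontier (((↑) : En n → OnePoint (En n)) '' G) → d ≤ dist a x ∧ d ≤ dist a y := by
    intro a ha
    have ha' : a ∈ frontier G := by
      have h := OnePoint.isOpenEmbedding_coe.isOpenMap.preimage_frontier_eq_frontier_preimage
        OnePoint.isOpenEmbedding_coe.continuous (((↑) : En n → OnePoint (En n)) '' G)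
      rw [Set.preimage_image_eq _ OnePoint.coe_injective] at h
      rw [← h]; exact ha
    refine ⟨hd1.trans ?_, hd2.trans ?_⟩
    · rw [dist_comm]; exact Metric.infDist_le_dist_of_mem ha'
    · rw [dist_comm]; exact Metric.infDist_le_dist_of_mem ha'
  have ht : 0 ≤ dist x y / d := by positivity
  apply Real.sSup_le
  · rintro r ⟨a, ha, b, hb, rfl⟩
    induction a using OnePoint.rec with
    | infty =>
      induction b using OnePoint.rec with
      | infty =>
        rw [cr_inf_inf]
        refine arcosh_bound _ _ (by simp) ht ?_ (fun _ => ?_)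
        · rw [zero_mul]; positivity
        · rw [zero_mul]; positivity
      | coe b =>
        obtain ⟨h1, h2⟩ := hF b hb
        rw [cr_inf' b x y (hd.trans_le h1) (hd.trans_le h2)]
        have := bound_inf b x y d hd h1 h2
        exact arcosh_bound _ _ (by positivity) ht (by nlinarith) (fun _ => by nlinarith)
    | coe a =>
      obtain ⟨h1, h2⟩ := hF a ha
      induction b using OnePoint.rec with
      | infty =>
        rw [cr_inf a x y (hd.trans_le h1) (hd.trans_le h2)]
        have := bound_inf a x y d hd h1 h2
        exact arcosh_bound _ _ (by positivity) ht (by nlinarith) (fun _ => by nlinarith)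
      | coe b =>
        obtain ⟨h3, h4⟩ := hF b hb
        rw [cr_fin a b x y (hd.trans_le h1) (hd.trans_le h2) (hd.trans_le h3) (hd.trans_le h4)]
        have := bound_fin a b x y d hd h1 h2 h3 h4
        exact arcosh_bound _ _ (by positivity) ht this.1 this.2
  · have h3 : 0 ≤ arcosh 3 := Real.log_nonneg (by
      have := Real.sqrt_nonneg ((3:ℝ)^2-1)
      linarith)
    exact mul_nonneg (div_nonneg h3 (Real.log_nonneg (by norm_num)))
      (Real.log_nonneg (by linarith))

end
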